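/- There exists a constant C > 0 such that for all real x ≥ 2, |Σ_{p, j : p prime, j ≥ 1, p^j ≤ x} (log p)/p^j − log x + γ| ≤ C/(log x), where γ is the Euler–Mascheroni constant. -/

import Mathlib

section

open Complex

lemma norm_cpow_sub_cpow_le_rpow {s : ℂ} (hs : 0 ≤ s.re) {θ : ℝ} (hθ : 0 ≤ θ) (hθ' : θ ≤ 1)
    {a x : ℝ} (ha : 0 < a) (hx : x ∈ Set.Icc a (a + 1)) :
    ‖(a : ℂ) ^ (-s) - (x : ℂ) ^ (-s)‖ ≤ 2 * ‖s‖ ^ θ * a ^ (-s.re - θ) := by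
  have hx0 : 0 < x := ha.trans_le hx.1
  have hmono : ∀ y : ℝ, a ≤ y → y ^ (-s.re) ≤ a ^ (-s.re) := fun y hy ↦
    Real.rpow_le_rpow_of_nonpos ha hy (by linarith)
  have htriv : ‖(a : ℂ) ^ (-s) - (x : ℂ) ^ (-s)‖ ≤ 2 * a ^ (-s.re) := by
    calc _ ≤ ‖(a : ℂ) ^ (-s)‖ + ‖(x : ℂ) ^ (-s)‖ := norm_sub_le _ _
      _ = a ^ (-s.re) + x ^ (-s.re) := by
        rw [norm_cpow_eq_rpow_re_of_pos ha, norm_cpow_eq_rpow_re_of_pos hx0, neg_re]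
      _ ≤ _ := by linarith [hmono x hx.1]
  have hmvt : ‖(a : ℂ) ^ (-s) - (x : ℂ) ^ (-s)‖ ≤ ‖s‖ * a ^ (-s.re - 1) := by
    rcases eq_or_ne s 0 with rfl | hs0
    · simp
    have hder : ∀ y ∈ Set.Icc a (a + 1),
        HasDerivWithinAt (fun y : ℝ ↦ (y : ℂ) ^ (-s)) (-s * (y : ℂ) ^ (-s - 1))
          (Set.Icc a (a + 1)) y := fun y hy ↦
      (hasDerivAt_ofReal_cpow_const (ha.trans_le hy.1).ne' (neg_ne_zero.2 hs0)).hasDerivWithinAt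
    have hbd : ∀ y ∈ Set.Icc a (a + 1), ‖-s * (y : ℂ) ^ (-s - 1)‖ ≤ ‖s‖ * a ^ (-s.re - 1) := by
      intro y hy
      rw [norm_mul, norm_neg, norm_cpow_eq_rpow_re_of_pos (ha.trans_le hy.1)]
      gcongr
      simpa using Real.rpow_le_rpow_of_nonpos ha hy.1 (by simp; linarith)
    have := (convex_Icc a (a + 1)).norm_image_sub_le_of_norm_hasDerivWithin_le hder hbd hx
      (Set.left_mem_Icc.2 (by linarith))
    refine this.trans (mul_le_of_le_one_right (by positivity) ?_)
    rw [Real.norm_eq_abs, abs_le]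
    constructor <;> linarith [hx.1, hx.2]
  rcases le_total 1 (‖s‖ / a) with h | h
  · refine htriv.trans ?_
    rw [sub_eq_add_neg, Real.rpow_add ha, Real.rpow_neg ha.le θ, mul_comm (a ^ (-s.re)), ← mul_assoc,
      mul_assoc 2, ← div_eq_mul_inv, ← Real.div_rpow (norm_nonneg _) ha.le]
    have := Real.one_le_rpow h hθ
    have h2 : 0 < a ^ (-s.re) := by positivity
    nlinarith
  · refine hmvt.trans ?_
    have h0 : ‖s‖ / a ≤ (‖s‖ / a) ^ θ := by
      simpa using Real.rpow_le_rpow_of_exponent_ge' (by positivity) h hθ hθ'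
    rw [sub_eq_add_neg, sub_eq_add_neg, Real.rpow_add ha, Real.rpow_add ha, Real.rpow_neg_one,
      Real.rpow_neg ha.le θ, mul_comm (a ^ (-s.re)), mul_comm (a ^ (-s.re)), ← mul_assoc,
      ← mul_assoc, mul_assoc 2, ← div_eq_mul_inv, ← div_eq_mul_inv,
      ← Real.div_rpow (norm_nonneg _) ha.le]
    have : 0 ≤ ‖s‖ / a := by positivity
    gcongr
    linarith

/-- The difference `(n + 1) ^ (-s) - ∫ x in (n + 1)..(n + 2), x ^ (-s)`. -/
noncomputable def zetaRemainderTerm (n : ℕ) (s : ℂ) : ℂ :=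
  ((n + 1 : ℝ) : ℂ) ^ (-s) -
    (((n + 1 + 1 : ℝ) : ℂ) ^ (1 - s) / (1 - s) - ((n + 1 : ℝ) : ℂ) ^ (1 - s) / (1 - s))

lemma norm_zetaRemainderTerm_le {s : ℂ} (hs : 0 ≤ s.re) (hs1 : s ≠ 1) {θ : ℝ} (hθ : 0 ≤ θ)
    (hθ' : θ ≤ 1) (n : ℕ) :
    ‖zetaRemainderTerm n s‖ ≤ 2 * ‖s‖ ^ θ * (n + 1 : ℝ) ^ (-s.re - θ) := by
  set a : ℝ := n + 1 with ha_def
  have ha : 0 < a := by positivity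
  have hder : ∀ y ∈ Set.Icc a (a + 1),
      HasDerivWithinAt (fun y : ℝ ↦ (y : ℂ) * (a : ℂ) ^ (-s) - (y : ℂ) ^ (1 - s) / (1 - s))
        ((a : ℂ) ^ (-s) - (y : ℂ) ^ (-s)) (Set.Icc a (a + 1)) y := by
    intro y hy
    have h1 := hasDerivAt_ofReal_cpow_const' (x := y) (r := -s) (ha.trans_le hy.1).ne' (by
      contrapose! hs1; linear_combination -hs1)
    rw [neg_add_eq_sub] at h1
    have h2 : HasDerivAt (fun y : ℝ ↦ (y : ℂ) * (a : ℂ) ^ (-s)) ((a : ℂ) ^ (-s)) y := by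
      simpa using (HasDerivAt.ofReal_comp (hasDerivAt_id y)).mul_const ((a : ℂ) ^ (-s))
    exact (h2.sub h1).hasDerivWithinAt
  have := (convex_Icc a (a + 1)).norm_image_sub_le_of_norm_hasDerivWithin_le hder
    (fun y hy ↦ norm_cpow_sub_cpow_le_rpow hs hθ hθ' ha hy)
    (Set.left_mem_Icc.2 (by linarith)) (Set.right_mem_Icc.2 (by linarith))
  rw [add_sub_cancel_left, norm_one, mul_one] at this
  refine le_trans (le_of_eq ?_) this
  unfold zetaRemainderTerm
  rw [← ha_def]
  congr 1
  push_cast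
  ring

lemma hasSum_zetaRemainderTerm_of_one_lt_re {s : ℂ} (hs : 1 < s.re) :
    HasSum (fun n ↦ zetaRemainderTerm n s) (riemannZeta s - 1 / (s - 1)) := by
  have hs1 : s ≠ 1 := by rintro rfl; simp at hs
  have h1 : HasSum (fun n : ℕ ↦ ((n + 1 : ℝ) : ℂ) ^ (-s)) (riemannZeta s) := by
    rw [zeta_eq_tsum_one_div_nat_add_one_cpow hs]
    have := ((summable_nat_add_iff 1).2 (Complex.summable_one_div_nat_cpow.2 hs)).hasSum
    convert! this using 2 with n n
    · push_cast; rw [cpow_neg, one_div]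
    · push_cast; rfl
  have h2 : HasSum (fun n : ℕ ↦ (((n + 1 + 1 : ℝ) : ℂ) ^ (1 - s) / (1 - s)
      - ((n + 1 : ℝ) : ℂ) ^ (1 - s) / (1 - s))) (1 / (s - 1)) := by
    have hlim : Filter.Tendsto (fun n : ℕ ↦ ((n + 1 : ℝ) : ℂ) ^ (1 - s) / (1 - s)) Filter.atTop
        (nhds 0) := by
      rw [tendsto_zero_iff_norm_tendsto_zero]
      have : ∀ n : ℕ, ‖((n + 1 : ℝ) : ℂ) ^ (1 - s) / (1 - s)‖
          = ((n + 1 : ℕ) : ℝ) ^ (-(s.re - 1)) / ‖1 - s‖ := fun n ↦ by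
        rw [norm_div, norm_cpow_eq_rpow_re_of_pos (by positivity)]
        simp
      simp_rw [this]
      rw [← zero_div ‖1 - s‖]
      refine Filter.Tendsto.div_const ?_ _
      exact (tendsto_rpow_neg_atTop (by linarith)).comp
        (tendsto_natCast_atTop_atTop.comp (Filter.tendsto_add_atTop_nat 1))
    have hsm : Summable (fun n : ℕ ↦ (((n + 1 + 1 : ℝ) : ℂ) ^ (1 - s) / (1 - s)
        - ((n + 1 : ℝ) : ℂ) ^ (1 - s) / (1 - s))) := by
      have h3 : Summable (fun n ↦ zetaRemainderTerm n s) := by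
        refine Summable.of_norm_bounded (g := fun n : ℕ ↦ 2 * ‖s‖ ^ (0 : ℝ) *
          ((n + 1 : ℕ) : ℝ) ^ (-s.re)) ?_ fun n ↦ ?_
        · exact ((summable_nat_add_iff 1).2 (Real.summable_nat_rpow.2 (by linarith))).mul_left _
        · simpa using norm_zetaRemainderTerm_le (by linarith) hs1 le_rfl zero_le_one n
      refine (h1.summable.sub h3).congr fun n ↦ ?_
      simp only [zetaRemainderTerm]; ring
    refine (hsm.hasSum_iff_tendsto_nat).2 ?_
    have := hlim.sub_const (((0 + 1 : ℝ) : ℂ) ^ (1 - s) / (1 - s))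
    convert! this using 1
    · ext n
      simpa using Finset.sum_range_sub
        (fun n : ℕ ↦ ((n + 1 : ℝ) : ℂ) ^ (1 - s) / (1 - s)) n
    · have : (1 : ℂ) - s ≠ 0 := sub_ne_zero.2 hs1.symm
      have : s - 1 ≠ 0 := sub_ne_zero.2 hs1
      simp
      grind
  exact h1.sub h2

lemma differentiableAt_zetaRemainderTerm (n : ℕ) {s : ℂ} (hs : s ≠ 1) :
    DifferentiableAt ℂ (zetaRemainderTerm n) s := by
  have h0 : 1 - s ≠ 0 := sub_ne_zero.2 hs.symm
  have h1 : ((n + 1 : ℝ) : ℂ) ≠ 0 := by exact_mod_cast (by positivity : (n + 1 : ℝ) ≠ 0)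
  have h2 : ((n + 1 + 1 : ℝ) : ℂ) ≠ 0 := by exact_mod_cast (by positivity : (n + 1 + 1 : ℝ) ≠ 0)
  unfold zetaRemainderTerm
  refine .sub ?_ (.sub (.div ?_ (by fun_prop) h0) (.div ?_ (by fun_prop) h0)) <;>
  exact DifferentiableAt.const_cpow (by fun_prop) (Or.inl (by assumption))

lemma riemannZeta_eq_tsum_zetaRemainderTerm {s : ℂ} (hs : 0 < s.re) (him : 0 < s.im) :
    riemannZeta s = 1 / (s - 1) + ∑' n, zetaRemainderTerm n s := by
  obtain ⟨δ, hδ0, hδs, hδ1⟩ : ∃ δ : ℝ, 0 < δ ∧ δ < s.re ∧ δ ≤ 1 :=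
    ⟨min (s.re / 2) 1, by positivity, (min_le_left _ _).trans_lt (by linarith), min_le_right _ _⟩
  set R : ℝ := ‖s‖ + 3
  let U : Set ℂ := {z | δ < z.re} ∩ {z | 0 < z.im} ∩ Metric.ball 0 R
  have hUo : IsOpen U := ((isOpen_lt continuous_const continuous_re).inter
    (isOpen_lt continuous_const continuous_im)).inter Metric.isOpen_ball
  have hUc : Convex ℝ U := ((convex_halfSpace_re_gt δ).inter (convex_halfSpace_im_gt 0)).inter
    (convex_ball _ _)
  have hU1 : ∀ z ∈ U, z ≠ 1 := by
    rintro z ⟨⟨-, hz⟩, -⟩ rfl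
    simp at hz
  have hf : DifferentiableOn ℂ riemannZeta U := fun z hz ↦
    (differentiableAt_riemannZeta (hU1 z hz)).differentiableWithinAt
  have hg : DifferentiableOn ℂ (fun z ↦ 1 / (z - 1) + ∑' n, zetaRemainderTerm n z) U := by
    refine .add (fun z hz ↦ ?_) ?_
    · have := sub_ne_zero.2 (hU1 z hz)
      exact DifferentiableAt.differentiableWithinAt (by fun_prop (disch := assumption))
    · refine differentiableOn_tsum_of_summable_norm
        (u := fun n : ℕ ↦ 2 * R * ((n + 1 : ℕ) : ℝ) ^ (-δ - 1)) ?_ (fun n z hz ↦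
        (differentiableAt_zetaRemainderTerm n (hU1 z hz)).differentiableWithinAt) hUo ?_
      · refine ((summable_nat_add_iff 1).2 (Real.summable_nat_rpow.2 ?_)).mul_left _
        linarith
      · rintro n z hz
        have hz1 : δ < z.re := hz.1.1
        have hz2 : ‖z‖ < R := by simpa using hz.2
        refine (norm_zetaRemainderTerm_le (by linarith) (hU1 z hz)
          zero_le_one le_rfl n).trans ?_
        rw [Real.rpow_one]
        push_cast
        gcongr
        linarith [n.cast_nonneg (α := ℝ)]
  have hw : (2 + s.im * I : ℂ) ∈ U := by
    refine ⟨⟨?_, by simpa using him⟩, ?_⟩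
    · change δ < _
      simp
      linarith
    · simp only [R, Metric.mem_ball, dist_zero_right]
      calc ‖(2 + s.im * I : ℂ)‖ ≤ ‖(2 : ℂ)‖ + ‖s.im * I‖ := norm_add_le _ _
        _ = 2 + |s.im| := by simp
        _ < _ := by linarith [abs_im_le_norm s]
  have hev : riemannZeta =ᶠ[nhds (2 + s.im * I : ℂ)]
      fun z ↦ 1 / (z - 1) + ∑' n, zetaRemainderTerm n z := by
    filter_upwards [(isOpen_lt continuous_const continuous_re).mem_nhds
      (show (1 : ℝ) < (2 + s.im * I : ℂ).re by simp)] with z hz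
    rw [(hasSum_zetaRemainderTerm_of_one_lt_re hz).tsum_eq]
    ring
  exact (hf.analyticOnNhd hUo).eqOn_of_preconnected_of_eventuallyEq (hg.analyticOnNhd hUo)
    hUc.isPreconnected hw hev ⟨⟨hδs, him⟩, by simp [R]⟩

lemma exists_norm_riemannZeta_le_of_im_pos :
    ∃ C > 0, ∀ s : ℂ, 63 / 64 ≤ s.re → s.re ≤ 4 → 1 ≤ s.im →
      ‖riemannZeta s‖ ≤ C * s.im ^ (1 / 32 : ℝ) := by
  have hsum : Summable fun n : ℕ ↦ ((n + 1 : ℕ) : ℝ) ^ (-(65 / 64) : ℝ) :=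
    (summable_nat_add_iff 1).2 (Real.summable_nat_rpow.2 (by norm_num))
  refine ⟨1 + 10 * ∑' n : ℕ, ((n + 1 : ℕ) : ℝ) ^ (-(65 / 64) : ℝ), by positivity,
    fun s hs hs4 him ↦ ?_⟩
  have hs1 : s ≠ 1 := by rintro rfl; norm_num at him
  have hnorm : ‖s‖ ≤ 5 * s.im := by
    have := norm_le_abs_re_add_abs_im s
    rw [abs_of_nonneg (by linarith), abs_of_nonneg (by linarith)] at this
    linarith
  have hy : 1 ≤ s.im ^ (1 / 32 : ℝ) := Real.one_le_rpow him (by norm_num)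
  have hpole : ‖1 / (s - 1)‖ ≤ 1 := by
    rw [norm_div, norm_one]
    refine div_le_one_of_le₀ ?_ (norm_nonneg _)
    have := abs_im_le_norm (s - 1)
    simp only [sub_im, one_im, sub_zero] at this
    exact him.trans ((le_abs_self _).trans this)
  have hterm : ∀ n, ‖zetaRemainderTerm n s‖ ≤
      10 * s.im ^ (1 / 32 : ℝ) * ((n + 1 : ℕ) : ℝ) ^ (-(65 / 64) : ℝ) := by
    intro n
    refine (norm_zetaRemainderTerm_le (by linarith) hs1 (θ := 1 / 32) (by norm_num) (by norm_num)
      n).trans ?_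
    push_cast
    have h1 : ‖s‖ ^ (1 / 32 : ℝ) ≤ 5 * s.im ^ (1 / 32 : ℝ) := by
      calc ‖s‖ ^ (1 / 32 : ℝ) ≤ (5 * s.im) ^ (1 / 32 : ℝ) := by gcongr
        _ = 5 ^ (1 / 32 : ℝ) * s.im ^ (1 / 32 : ℝ) := Real.mul_rpow (by norm_num) (by linarith)
        _ ≤ 5 * s.im ^ (1 / 32 : ℝ) := by
          gcongr
          exact Real.rpow_le_self_of_one_le (by norm_num) (by norm_num)
    have h2 : (n + 1 : ℝ) ^ (-s.re - 1 / 32) ≤ (n + 1 : ℝ) ^ (-(65 / 64) : ℝ) :=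
      Real.rpow_le_rpow_of_exponent_le (by linarith [n.cast_nonneg (α := ℝ)]) (by linarith)
    calc _ ≤ 2 * (5 * s.im ^ (1 / 32 : ℝ)) * (n + 1 : ℝ) ^ (-(65 / 64) : ℝ) := by gcongr
      _ = _ := by ring
  rw [riemannZeta_eq_tsum_zetaRemainderTerm (by linarith) (by linarith)]
  calc _ ≤ ‖1 / (s - 1)‖ + ‖∑' n, zetaRemainderTerm n s‖ := norm_add_le _ _
    _ ≤ 1 + 10 * s.im ^ (1 / 32 : ℝ) * ∑' n : ℕ, ((n + 1 : ℕ) : ℝ) ^ (-(65 / 64) : ℝ) :=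
      add_le_add hpole (tsum_of_norm_bounded (hsum.hasSum.mul_left _) hterm)
    _ ≤ _ := by linarith

lemma exists_norm_riemannZeta_le :
    ∃ C > 0, ∀ s : ℂ, 63 / 64 ≤ s.re → s.re ≤ 4 → 1 ≤ |s.im| →
      ‖riemannZeta s‖ ≤ C * |s.im| ^ (1 / 32 : ℝ) := by
  obtain ⟨C, hC, h⟩ := exists_norm_riemannZeta_le_of_im_pos
  refine ⟨C, hC, fun s hs hs4 him ↦ ?_⟩
  rcases le_total 0 s.im with h0 | h0
  · rw [abs_of_nonneg h0] at him ⊢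
    exact h s hs hs4 him
  · rw [abs_of_nonpos h0] at him ⊢
    simpa using h (starRingEnd ℂ s) (by simpa) (by simpa) (by simpa)

lemma rpow_one_div_le_two_mul {a b : ℝ} (ha : 0 ≤ a) (hab : a ≤ 2 * b) :
    a ^ (1 / 32 : ℝ) ≤ 2 * b ^ (1 / 32 : ℝ) := by
  calc a ^ (1 / 32 : ℝ) ≤ (2 * b) ^ (1 / 32 : ℝ) := by gcongr
    _ = 2 ^ (1 / 32 : ℝ) * b ^ (1 / 32 : ℝ) := Real.mul_rpow (by norm_num) (by linarith)
    _ ≤ 2 * b ^ (1 / 32 : ℝ) := by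
      have : 0 ≤ b := by linarith
      gcongr
      exact Real.rpow_le_self_of_one_le (by norm_num) (by norm_num)

lemma abs_re_sub_le_and_abs_im_sub_le {z s : ℂ} {r : ℝ} (hz : ‖z - s‖ ≤ r) :
    |z.re - s.re| ≤ r ∧ |z.im - s.im| ≤ r :=
  ⟨(abs_re_le_norm (z - s)).trans hz, (abs_im_le_norm (z - s)).trans hz⟩

lemma exists_norm_deriv_riemannZeta_le :
    ∃ C > 0, ∀ s : ℂ, 127 / 128 ≤ s.re → s.re ≤ 3 → 2 ≤ |s.im| →
      ‖deriv riemannZeta s‖ ≤ C * |s.im| ^ (1 / 32 : ℝ) := by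
  obtain ⟨C, hC, h⟩ := exists_norm_riemannZeta_le
  refine ⟨C * 2 / (1 / 128), by positivity, fun s hs hs3 him ↦ ?_⟩
  have hmem : ∀ z ∈ Metric.closedBall s (1 / 128), 63 / 64 ≤ z.re ∧ z.re ≤ 4 ∧ 1 ≤ |z.im| ∧
      |z.im| ≤ 2 * |s.im| := by
    intro z hz
    obtain ⟨h1, h2⟩ := abs_re_sub_le_and_abs_im_sub_le (mem_closedBall_iff_norm.1 hz)
    have h3 := abs_sub_abs_le_abs_sub z.im s.im
    have h4 := abs_sub_abs_le_abs_sub s.im z.im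
    rw [abs_sub_comm] at h4
    rw [abs_le] at h1
    refine ⟨?_, ?_, ?_, ?_⟩ <;> linarith [h1.1, h1.2]
  have hd : DifferentiableOn ℂ riemannZeta (Metric.closedBall s (1 / 128)) := fun z hz ↦
    (differentiableAt_riemannZeta (by
      rintro rfl
      have := (hmem 1 hz).2.2.1
      norm_num at this)).differentiableWithinAt
  refine (norm_deriv_le_of_forall_mem_sphere_norm_le (R := 1 / 128)
    (C := C * (2 * |s.im| ^ (1 / 32 : ℝ))) (by norm_num) (hd.diffContOnCl_ball subset_rfl) fun z hz ↦ ?_).trans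
    (le_of_eq (by ring))
  obtain ⟨h1, h2, h3, h4⟩ := hmem z (Metric.sphere_subset_closedBall hz)
  refine (h z h1 h2 h3).trans ?_
  gcongr
  exact rpow_one_div_le_two_mul (abs_nonneg _) h4

lemma one_le_norm_riemannZeta_product {x : ℝ} (hx : 0 < x) (y : ℝ) :
    1 ≤ ‖riemannZeta (1 + x)‖ ^ 3 * ‖riemannZeta (1 + x + I * y)‖ ^ 4 *
      ‖riemannZeta (1 + x + 2 * I * y)‖ := by
  have := DirichletCharacter.norm_LFunction_product_ge_one (N := 1) 1 hx y
  simpa [DirichletCharacter.LFunctionTrivChar, DirichletCharacter.LFunction_modOne_eq] using this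

lemma exists_norm_riemannZeta_one_add_le :
    ∃ C > 0, ∀ x : ℝ, 0 < x → x ≤ 2 → ‖riemannZeta (1 + x)‖ ≤ C / x := by
  obtain ⟨C, hC⟩ := (isCompact_Icc (a := (0 : ℝ)) (b := 2)).exists_bound_of_continuousOn
    (f := fun x : ℝ ↦ riemannZeta₁ (1 + x)) (by
      have := differentiable_riemannZeta₁.continuous
      fun_prop)
  refine ⟨max C 1, by positivity, fun x hx hx2 ↦ ?_⟩
  have h1 : (1 + x : ℂ) ≠ 1 := by simpa using hx.ne'
  rw [riemannZeta_eq_inv_sub_mul h1, norm_mul, add_sub_cancel_left, norm_inv, norm_real,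
    Real.norm_of_nonneg hx.le, inv_mul_eq_div]
  gcongr
  exact (hC x ⟨hx.le, hx2⟩).trans (le_max_left _ _)

lemma exists_le_norm_riemannZeta_pow_four :
    ∃ c > 0, ∀ (x t : ℝ), 0 < x → x ≤ 2 → 2 ≤ |t| →
      c * x ^ 3 / |t| ^ (1 / 32 : ℝ) ≤ ‖riemannZeta (1 + x + I * t)‖ ^ 4 := by
  obtain ⟨A, hA, hA'⟩ := exists_norm_riemannZeta_one_add_le
  obtain ⟨B, hB, hB'⟩ := exists_norm_riemannZeta_le
  refine ⟨1 / (A ^ 3 * (B * 2)), by positivity, fun x t hx hx2 ht ↦ ?_⟩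
  have hprod := one_le_norm_riemannZeta_product hx t
  have h1 := hA' x hx hx2
  have h2 : ‖riemannZeta (1 + x + 2 * I * t)‖ ≤ B * (2 * |t| ^ (1 / 32 : ℝ)) := by
    refine (hB' (1 + x + 2 * I * t) (by simp; linarith) (by simp; linarith)
      (by simp [abs_mul]; linarith)).trans ?_
    gcongr
    exact rpow_one_div_le_two_mul (abs_nonneg _) (by simp [abs_mul])
  have hy : 0 < |t| ^ (1 / 32 : ℝ) := by positivity
  have h3 : 1 ≤ (A / x) ^ 3 * ‖riemannZeta (1 + x + I * t)‖ ^ 4 *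
      (B * (2 * |t| ^ (1 / 32 : ℝ))) := hprod.trans (by gcongr)
  rw [div_le_iff₀ hy, div_mul_eq_mul_div, one_mul, div_le_iff₀ (by positivity)]
  rw [div_pow, div_mul_eq_mul_div, div_mul_eq_mul_div, le_div_iff₀ (by positivity)] at h3
  linarith

lemma norm_riemannZeta_sub_le {B t a b : ℝ}
    (hB : ∀ s : ℂ, 127 / 128 ≤ s.re → s.re ≤ 3 → 2 ≤ |s.im| →
      ‖deriv riemannZeta s‖ ≤ B * |s.im| ^ (1 / 32 : ℝ))
    (ht : 2 ≤ |t|) (ha : a ∈ Set.Icc (127 / 128) 3) (hb : b ∈ Set.Icc (127 / 128 : ℝ) 3) :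
    ‖riemannZeta (b + I * t) - riemannZeta (a + I * t)‖ ≤
      B * |t| ^ (1 / 32 : ℝ) * |b - a| := by
  have := (convex_Icc (127 / 128 : ℝ) 3).norm_image_sub_le_of_norm_hasDerivWithin_le
    (f := fun x : ℝ ↦ riemannZeta (x + I * t)) (f' := fun x ↦ deriv riemannZeta (x + I * t))
    (C := B * |t| ^ (1 / 32 : ℝ)) (fun x hx ↦ ?_) (fun x hx ↦ ?_) ha hb
  · simpa using this
  · have h1 : (x + I * t : ℂ) ≠ 1 := by
      intro h
      have := congrArg im h
      simp at this
      norm_num [this] at ht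
    have h2 := (differentiableAt_riemannZeta h1).hasDerivAt.comp_add_const (x : ℂ) (I * t)
    exact h2.comp_ofReal.hasDerivWithinAt
  · simpa using hB (x + I * t) (by simpa using hx.1) (by simpa using hx.2) (by simpa)

/-- A zero-free region for `ζ` of polynomial width, with a polynomial lower bound. -/
lemma exists_le_norm_riemannZeta :
    ∃ κ > 0, κ ≤ 1 / 128 ∧ ∃ c > 0, ∀ s : ℂ, 1 - κ / (|s.im| ^ (1 / 32 : ℝ)) ^ 5 ≤ s.re →
      s.re ≤ 3 → 2 ≤ |s.im| → c / (|s.im| ^ (1 / 32 : ℝ)) ^ 4 ≤ ‖riemannZeta s‖ := by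
  obtain ⟨c, hc, hc'⟩ := exists_le_norm_riemannZeta_pow_four
  obtain ⟨B, hB, hB'⟩ := exists_norm_deriv_riemannZeta_le
  obtain ⟨d, hd, hdc⟩ : ∃ d : ℝ, 0 < d ∧ d ^ 4 = c :=
    ⟨c ^ (1 / 4 : ℝ), by positivity, by rw [← Real.rpow_natCast, ← Real.rpow_mul hc.le]; norm_num⟩
  set l : ℝ := min (1 / 4) (d / (4 * B))
  have hl : 0 < l := by positivity
  have hl4 : l ≤ 1 / 4 := min_le_left _ _
  have hlB : B * l ≤ d / 4 := by
    have : l ≤ d / (4 * B) := min_le_right _ _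
    rw [le_div_iff₀ (by positivity)] at this
    linarith
  have hκ : l ^ 4 ≤ 1 / 128 :=
    (pow_le_pow_left₀ hl.le hl4 4).trans (by norm_num)
  refine ⟨l ^ 4, by positivity, hκ, d * l ^ 3 / 2, by positivity, fun s hs hs3 him ↦ ?_⟩
  set y := |s.im| ^ (1 / 32 : ℝ)
  have hy : 1 ≤ y := Real.one_le_rpow (by linarith) (by norm_num)
  have hy0 : 0 < y := by linarith
  set x₀ := l ^ 4 / y ^ 5
  have hx₀ : 0 < x₀ := by positivity
  have hx₀' : x₀ ≤ 1 / 128 := (div_le_self (by positivity) (one_le_pow₀ hy)).trans hκ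
  have hlow : ∀ x : ℝ, x₀ ≤ x → x ≤ 2 →
      d * l ^ 3 / y ^ 4 ≤ ‖riemannZeta (1 + x + I * s.im)‖ := by
    intro x hx hx2
    refine le_of_pow_le_pow_left₀ (n := 4) (by norm_num) (norm_nonneg _) ?_
    refine le_trans ?_ (hc' x s.im (hx₀.trans_le hx) hx2 him)
    calc (d * l ^ 3 / y ^ 4) ^ 4 = c * x₀ ^ 3 / y := by
          rw [← hdc]; simp only [x₀]; field_simp
      _ ≤ c * x ^ 3 / y := by gcongr
  have hs_eq : s = (s.re : ℂ) + I * s.im := by rw [mul_comm]; exact (re_add_im s).symm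
  rcases le_total (1 + x₀) s.re with h | h
  · have := hlow (s.re - 1) (by linarith) (by linarith)
    push_cast at this
    rw [add_sub_cancel, ← hs_eq] at this
    refine le_trans ?_ this
    gcongr
    have : 0 < d * l ^ 3 := by positivity
    linarith
  · have h1 := hlow x₀ le_rfl (by linarith)
    have h2 := norm_riemannZeta_sub_le hB' him (a := s.re) (b := 1 + x₀)
      ⟨by linarith, hs3⟩ ⟨by linarith, by linarith⟩
    rw [← hs_eq] at h2
    push_cast at h2
    have h3 : |1 + x₀ - s.re| ≤ 2 * x₀ := by
      rw [abs_of_nonneg (by linarith)]; linarith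
    have h4 : B * y * |1 + x₀ - s.re| ≤ d * l ^ 3 / 2 / y ^ 4 := by
      calc B * y * |1 + x₀ - s.re| ≤ B * y * (2 * x₀) := by gcongr
        _ = (B * l) * (2 * l ^ 3) / y ^ 4 := by simp only [x₀]; field_simp
        _ ≤ d / 4 * (2 * l ^ 3) / y ^ 4 := by gcongr
        _ = _ := by ring
    have h5 := norm_sub_norm_le (riemannZeta (1 + x₀ + I * s.im)) (riemannZeta s)
    have h6 : d * l ^ 3 / y ^ 4 = d * l ^ 3 / 2 / y ^ 4 + d * l ^ 3 / 2 / y ^ 4 := by ring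
    linarith

/-- The function `(L(1 + s) - 1 / s + γ) / (s (s + 1))`, where `-L` is the logarithmic derivative
of `ζ`, with its singularity at `0` removed. -/
noncomputable def zetaKernel (s : ℂ) : ℂ :=
  dslope (fun z ↦ (Real.eulerMascheroniConstant : ℂ) - logDeriv riemannZeta₁ (1 + z)) 0 s / (s + 1)

/-- The open set of those `s` for which `1 + s` is not a zero of `(s - 1) ζ(s)`. -/
def zetaKernelDomain : Set ℂ := {s | -1 < s.re ∧ riemannZeta₁ (1 + s) ≠ 0}

lemma isOpen_zetaKernelDomain : IsOpen zetaKernelDomain := by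
  have := differentiable_riemannZeta₁.continuous
  exact (isOpen_lt continuous_const continuous_re).inter
    (isOpen_ne_fun (by fun_prop) continuous_const)

lemma riemannZeta₁_eq_sub_mul {s : ℂ} (hs : s ≠ 1) : riemannZeta₁ s = (s - 1) * riemannZeta s := by
  have := sub_ne_zero.2 hs
  rw [riemannZeta_eq_inv_sub_mul hs, mul_inv_cancel_left₀ this]

lemma mem_zetaKernelDomain_of_ne_zero {s : ℂ} (hs : -1 < s.re) (hs0 : s ≠ 0)
    (h : riemannZeta (1 + s) ≠ 0) : s ∈ zetaKernelDomain := by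
  refine ⟨hs, ?_⟩
  rw [riemannZeta₁_eq_sub_mul (by simpa using hs0)]
  simpa [hs0] using h

lemma zero_mem_zetaKernelDomain : (0 : ℂ) ∈ zetaKernelDomain := by
  simp [zetaKernelDomain]

lemma mem_zetaKernelDomain_of_re_nonneg {s : ℂ} (hs : 0 ≤ s.re) : s ∈ zetaKernelDomain := by
  rcases eq_or_ne s 0 with rfl | h0
  · exact zero_mem_zetaKernelDomain
  · exact mem_zetaKernelDomain_of_ne_zero (by linarith) h0
      (riemannZeta_ne_zero_of_one_le_re (by simpa))

lemma differentiableOn_zetaKernel : DifferentiableOn ℂ zetaKernel zetaKernelDomain := by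
  have hd' : Differentiable ℂ (deriv riemannZeta₁) := by
    have := (differentiable_riemannZeta₁.contDiff (n := 2)).differentiable_deriv_two
    exact this
  refine .div ?_ (by fun_prop) fun s hs h ↦ ?_
  · rw [differentiableOn_dslope (isOpen_zetaKernelDomain.mem_nhds zero_mem_zetaKernelDomain)]
    refine .const_sub ?_ _
    simp only [logDeriv, Pi.div_apply]
    refine .div ?_ ?_ fun s hs ↦ hs.2
    · exact (hd'.comp (by fun_prop : Differentiable ℂ fun z : ℂ ↦ 1 + z)).differentiableOn
    · exact (differentiable_riemannZeta₁.comp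
        (by fun_prop : Differentiable ℂ fun z : ℂ ↦ 1 + z)).differentiableOn
  · have := hs.1
    rw [eq_neg_of_add_eq_zero_left h] at this
    simp at this

lemma zetaKernel_eq {s : ℂ} (hs0 : s ≠ 0) (h : riemannZeta (1 + s) ≠ 0) :
    zetaKernel s = (-(deriv riemannZeta (1 + s) / riemannZeta (1 + s)) - 1 / s +
      Real.eulerMascheroniConstant) / (s * (s + 1)) := by
  have h1 : (1 + s : ℂ) ≠ 1 := by simpa using hs0
  have hlog : logDeriv riemannZeta₁ (1 + s) =
      1 / s + deriv riemannZeta (1 + s) / riemannZeta (1 + s) := by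
    have hev : riemannZeta₁ =ᶠ[nhds (1 + s)] fun z ↦ (z - 1) * riemannZeta z := by
      filter_upwards [isOpen_ne.mem_nhds h1] with z hz using riemannZeta₁_eq_sub_mul hz
    have heq : logDeriv riemannZeta₁ (1 + s) =
        logDeriv (fun z ↦ (z - 1) * riemannZeta z) (1 + s) := by
      simp only [logDeriv, Pi.div_apply, hev.deriv_eq, hev.eq_of_nhds]
    rw [heq, logDeriv_mul _ (by simpa using hs0) h (by fun_prop)
      (differentiableAt_riemannZeta h1)]
    simp [logDeriv]
  have h0 : logDeriv riemannZeta₁ 1 = Real.eulerMascheroniConstant := by simp [logDeriv]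
  simp only [zetaKernel, dslope_of_ne _ hs0, slope_def_field, add_zero, h0, hlog, sub_self, sub_zero]
  rw [div_div]
  congr 1
  ring

lemma exists_norm_zetaKernel_le :
    ∃ κ > 0, κ ≤ 1 / 128 ∧ ∃ C > 0, ∀ s : ℂ, -(κ / (|s.im| ^ (1 / 32 : ℝ)) ^ 5) ≤ s.re →
      s.re ≤ 2 → 2 ≤ |s.im| → s ∈ zetaKernelDomain ∧
        ‖zetaKernel s‖ ≤ C * (|s.im| ^ (1 / 32 : ℝ)) ^ 5 / |s.im| ^ 2 := by
  obtain ⟨κ, hκ, hκ', c, hc, hlow⟩ := exists_le_norm_riemannZeta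
  obtain ⟨B, hB, hder⟩ := exists_norm_deriv_riemannZeta_le
  refine ⟨κ, hκ, hκ', B / c + 1 + 1, by positivity, fun s hs hs2 him ↦ ?_⟩
  have hlow' := hlow (1 + s) (by simp; linarith) (by simp; linarith) (by simpa)
  simp only [add_im, one_im, zero_add] at hlow'
  set y := |s.im| ^ (1 / 32 : ℝ)
  have hy : 1 ≤ y := Real.one_le_rpow (by linarith) (by norm_num)
  have hy5 : κ / y ^ 5 ≤ 1 / 128 := (div_le_self hκ.le (one_le_pow₀ hy)).trans hκ'
  have hder' := hder (1 + s) (by simp; linarith) (by simp; linarith) (by simpa)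
  simp only [add_im, one_im, zero_add] at hder'
  have hζ : riemannZeta (1 + s) ≠ 0 := norm_pos_iff.1 (lt_of_lt_of_le (by positivity) hlow')
  have hs0 : s ≠ 0 := by rintro rfl; norm_num at him
  refine ⟨mem_zetaKernelDomain_of_ne_zero (by linarith) hs0 hζ, ?_⟩
  have him0 : 0 < |s.im| := by linarith
  have hns : |s.im| ≤ ‖s‖ := abs_im_le_norm s
  have hns1 : |s.im| ≤ ‖s + 1‖ := by simpa using abs_im_le_norm (s + 1)
  have hγ : ‖(Real.eulerMascheroniConstant : ℂ)‖ ≤ 1 := by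
    rw [norm_real, Real.norm_of_nonneg]
    · linarith [Real.eulerMascheroniConstant_lt_two_thirds]
    · linarith [Real.one_half_lt_eulerMascheroniConstant]
  have hlogd : ‖deriv riemannZeta (1 + s) / riemannZeta (1 + s)‖ ≤ B / c * y ^ 5 := by
    rw [norm_div]
    calc _ ≤ B * y / (c / y ^ 4) := by gcongr
      _ = _ := by field_simp
  have hinv : ‖1 / s‖ ≤ 1 := by
    rw [norm_div, norm_one]
    exact div_le_one_of_le₀ (by linarith) (norm_nonneg _)
  rw [zetaKernel_eq hs0 hζ, norm_div, norm_mul, sq]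
  gcongr
  calc _ ≤ ‖deriv riemannZeta (1 + s) / riemannZeta (1 + s)‖ + ‖1 / s‖ +
        ‖(Real.eulerMascheroniConstant : ℂ)‖ := by
        refine (norm_add_le _ _).trans (add_le_add ((norm_sub_le _ _).trans ?_) le_rfl)
        rw [norm_neg]
    _ ≤ B / c * y ^ 5 + 1 + 1 := by gcongr
    _ ≤ (B / c + 1 + 1) * y ^ 5 := by
      have := one_le_pow₀ hy (n := 5)
      linarith

lemma exists_norm_iteratedDeriv_zetaKernel_le_of_le_abs_im :
    ∃ C > 0, ∀ s : ℂ, 0 ≤ s.re → s.re ≤ 1 → 4 ≤ |s.im| → ∀ n ≤ 2,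
      ‖iteratedDeriv n zetaKernel s‖ ≤ C * |s.im| ^ (-(3 / 2) : ℝ) := by
  obtain ⟨κ, hκ, hκ', C, hC, h⟩ := exists_norm_zetaKernel_le
  refine ⟨2 * (C * 32 / (1 / 4)) / (κ / 32) ^ 2, by positivity, fun s hs hs1 him n hn ↦ ?_⟩
  set y := |s.im| ^ (1 / 32 : ℝ) with hy_def
  have hy : 1 ≤ y := Real.one_le_rpow (by linarith) (by norm_num)
  set r := κ / 32 / y ^ 5
  have hr : 0 < r := by positivity
  have hr' : r ≤ κ / 32 := div_le_self (by positivity) (one_le_pow₀ hy)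
  have hmem : ∀ z ∈ Metric.closedBall s r, z ∈ zetaKernelDomain ∧
      ‖zetaKernel z‖ ≤ C * 32 / (1 / 4) * y ^ 5 / |s.im| ^ 2 := by
    intro z hz
    obtain ⟨h1, h2⟩ := abs_re_sub_le_and_abs_im_sub_le (mem_closedBall_iff_norm.1 hz)
    have h3 := abs_sub_abs_le_abs_sub z.im s.im
    have h4 := abs_sub_abs_le_abs_sub s.im z.im
    rw [abs_sub_comm] at h4
    rw [abs_le] at h1
    have hyz : |z.im| ^ (1 / 32 : ℝ) ≤ 2 * y :=
      rpow_one_div_le_two_mul (abs_nonneg _) (by linarith)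
    have hz0 : 0 < |z.im| := by linarith
    have hrz : r ≤ κ / (|z.im| ^ (1 / 32 : ℝ)) ^ 5 := by
      calc r = κ / (2 * y) ^ 5 := by simp only [r]; field_simp; norm_num
        _ ≤ _ := by gcongr
    obtain ⟨h5, h6⟩ := h z (by linarith) (by linarith) (by linarith)
    refine ⟨h5, h6.trans ?_⟩
    calc _ ≤ C * (2 * y) ^ 5 / (|s.im| / 2) ^ 2 := by
          gcongr
          linarith
      _ = _ := by field_simp; norm_num
  have hd : DifferentiableOn ℂ zetaKernel (Metric.closedBall s r) :=
    differentiableOn_zetaKernel.mono fun z hz ↦ (hmem z hz).1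
  refine (norm_iteratedDeriv_le_of_forall_mem_sphere_norm_le n hr
    (hd.diffContOnCl_ball subset_rfl) fun z hz ↦
      (hmem z (Metric.sphere_subset_closedBall hz)).2).trans ?_
  have hfac : (n.factorial : ℝ) ≤ 2 := by
    have := Nat.factorial_le hn
    exact_mod_cast this
  have hrn : r ^ 2 ≤ r ^ n := pow_le_pow_of_le_one hr.le (by linarith) hn
  have hy15 : y ^ 15 ≤ |s.im| ^ (1 / 2 : ℝ) := by
    rw [hy_def, ← Real.rpow_natCast, ← Real.rpow_mul (abs_nonneg _)]
    exact Real.rpow_le_rpow_of_exponent_le (by linarith) (by norm_num)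
  have hpow : |s.im| ^ (-(3 / 2) : ℝ) = |s.im| ^ (1 / 2 : ℝ) / |s.im| ^ 2 := by
    rw [← Real.rpow_natCast, ← Real.rpow_sub (by linarith)]
    norm_num
  rw [hpow]
  calc _ ≤ 2 * (C * 32 / (1 / 4) * y ^ 5 / |s.im| ^ 2) / r ^ 2 := by gcongr
    _ = 2 * (C * 32 / (1 / 4)) / (κ / 32) ^ 2 * (y ^ 15 / |s.im| ^ 2) := by
      simp only [r]; field_simp
    _ ≤ _ := by gcongr

lemma differentiableOn_iteratedDeriv_zetaKernel (n : ℕ) :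
    DifferentiableOn ℂ (iteratedDeriv n zetaKernel) zetaKernelDomain := by
  induction n with
  | zero => simpa using differentiableOn_zetaKernel
  | succ n ih =>
    rw [iteratedDeriv_succ]
    exact ih.deriv isOpen_zetaKernelDomain

lemma exists_norm_iteratedDeriv_zetaKernel_le :
    ∃ C > 0, ∀ s : ℂ, 0 ≤ s.re → s.re ≤ 1 → ∀ n ≤ 2,
      ‖iteratedDeriv n zetaKernel s‖ ≤ C * (1 + |s.im|) ^ (-(3 / 2) : ℝ) := by
  obtain ⟨C₁, hC₁, h₁⟩ := exists_norm_iteratedDeriv_zetaKernel_le_of_le_abs_im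
  have hcomp : IsCompact (Set.Icc (0 : ℝ) 1 ×ℂ Set.Icc (-4 : ℝ) 4) :=
    isCompact_Icc.reProdIm isCompact_Icc
  have hbd : ∀ n, ∃ M, ∀ s ∈ Set.Icc (0 : ℝ) 1 ×ℂ Set.Icc (-4 : ℝ) 4,
      ‖iteratedDeriv n zetaKernel s‖ ≤ M := fun n ↦
    hcomp.exists_bound_of_continuousOn ((differentiableOn_iteratedDeriv_zetaKernel n).continuousOn.mono
      fun s hs ↦ mem_zetaKernelDomain_of_re_nonneg hs.1.1)
  choose M hM using hbd
  set M' := max (max (M 0) (M 1)) (max (M 2) 1)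
  have hM' : 0 < M' := by positivity
  have hpos : (0 : ℝ) < 5 ^ (3 / 2 : ℝ) := by positivity
  refine ⟨C₁ * 2 ^ (3 / 2 : ℝ) + M' * 5 ^ (3 / 2 : ℝ), by positivity, fun s hs hs1 n hn ↦ ?_⟩
  rw [add_mul]
  rcases le_total 4 |s.im| with h | h
  · refine (h₁ s hs hs1 h n hn).trans (le_add_of_le_of_nonneg ?_ (by positivity))
    rw [mul_assoc]
    gcongr
    calc |s.im| ^ (-(3 / 2) : ℝ) = 2 ^ (3 / 2 : ℝ) * (2 * |s.im|) ^ (-(3 / 2) : ℝ) := by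
          rw [Real.mul_rpow (by norm_num) (abs_nonneg _), ← mul_assoc,
            ← Real.rpow_add (by norm_num)]
          simp
      _ ≤ _ := by
        gcongr 2 ^ (3 / 2 : ℝ) * ?_
        exact Real.rpow_le_rpow_of_nonpos (by positivity) (by linarith) (by norm_num)
  · refine le_add_of_nonneg_of_le (by positivity) ?_
    have hMn : M n ≤ M' := by
      interval_cases n <;> simp [M']
    refine (hM n s ⟨⟨hs, hs1⟩, abs_le.1 h⟩).trans (hMn.trans ?_)
    rw [mul_assoc]
    refine le_mul_of_one_le_right hM'.le ?_
    rw [Real.rpow_neg (by positivity), ← div_eq_mul_inv, one_le_div (by positivity)]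
    gcongr
    linarith

open MeasureTheory in
lemma integrable_tsum_of_summable_integral_norm {α : Type*} [MeasurableSpace α]
    {μ : Measure α} {F : ℕ → α → ℂ} (hF : ∀ n, Integrable (F n) μ)
    (hs : Summable fun n ↦ ∫ a, ‖F n a‖ ∂μ) (hm : AEStronglyMeasurable (fun a ↦ ∑' n, F n a) μ) :
    Integrable (fun a ↦ ∑' n, F n a) μ := by
  refine ⟨hm, ?_⟩
  have h1 : ∑' n, ∫⁻ a, ‖F n a‖ₑ ∂μ ≠ ⊤ := by
    have (n : ℕ) : ∫⁻ a, ‖F n a‖ₑ ∂μ = ENNReal.ofReal (∫ a, ‖F n a‖ ∂μ) :=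
      (ofReal_integral_norm_eq_lintegral_enorm (hF n)).symm
    simp_rw [this]
    exact hs.tsum_ofReal_ne_top
  calc ∫⁻ a, ‖∑' n, F n a‖ₑ ∂μ ≤ ∫⁻ a, ∑' n, ‖F n a‖ₑ ∂μ :=
        lintegral_mono fun a ↦ enorm_tsum_le_tsum_enorm
    _ = ∑' n, ∫⁻ a, ‖F n a‖ₑ ∂μ := lintegral_tsum fun n ↦ (hF n).1.enorm
    _ < ⊤ := h1.lt_top

section translates

open MeasureTheory FourierTransform

variable {a : ℕ → ℂ} {x : ℕ → ℝ} {ψ : ℝ → ℂ}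

lemma continuous_tsum_translates (ha : Summable a) (hc : Continuous ψ) {M : ℝ}
    (hM : ∀ v, ‖ψ v‖ ≤ M) : Continuous fun u ↦ ∑' n, a n * ψ (u - x n) := by
  refine continuous_tsum (u := fun n ↦ ‖a n‖ * M) (fun n ↦ by fun_prop) (ha.norm.mul_right M)
    fun n u ↦ ?_
  rw [norm_mul]
  gcongr
  exact hM _

lemma summable_integral_norm_translates (ha : Summable a) :
    Summable fun n ↦ ∫ u, ‖a n * ψ (u - x n)‖ := by
  have (n : ℕ) : ∫ u, ‖a n * ψ (u - x n)‖ = ‖a n‖ * ∫ u, ‖ψ u‖ := by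
    simp_rw [norm_mul]
    rw [integral_const_mul, integral_sub_right_eq_self (fun u ↦ ‖ψ u‖)]
  simp_rw [this]
  exact ha.norm.mul_right _

lemma integrable_tsum_translates (ha : Summable a) (hc : Continuous ψ) (hi : Integrable ψ) {M : ℝ}
    (hM : ∀ v, ‖ψ v‖ ≤ M) : Integrable fun u ↦ ∑' n, a n * ψ (u - x n) :=
  integrable_tsum_of_summable_integral_norm (fun n ↦ (hi.comp_sub_right (x n)).const_mul (a n))
    (summable_integral_norm_translates ha)
    (continuous_tsum_translates ha hc hM).aestronglyMeasurable

lemma fourier_tsum_translates (ha : Summable a) (hi : Integrable ψ) (τ : ℝ) :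
    𝓕 (fun u ↦ ∑' n, a n * ψ (u - x n)) τ =
      (∑' n, a n * exp (-2 * Real.pi * x n * τ * I)) * 𝓕 ψ τ := by
  rw [Real.fourier_real_eq_integral_exp_smul, Real.fourier_real_eq_integral_exp_smul,
    ← tsum_mul_right]
  have hnorm (n : ℕ) (u : ℝ) : ‖exp (↑(-2 * Real.pi * u * τ) * I) • (a n * ψ (u - x n))‖ =
      ‖a n * ψ (u - x n)‖ := by
    rw [norm_smul, norm_exp_ofReal_mul_I, one_mul]
  have hint (n : ℕ) : Integrable fun u : ℝ ↦
      exp (↑(-2 * Real.pi * u * τ) * I) • (a n * ψ (u - x n)) := by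
    have h := (hi.comp_sub_right (x n)).const_mul (a n)
    have hc : Continuous fun u : ℝ ↦ exp (↑(-2 * Real.pi * u * τ) * I) := by fun_prop
    refine ⟨hc.aestronglyMeasurable.smul h.1, ?_⟩
    exact h.2.mono (.of_forall fun u ↦ (hnorm n u).le)
  have := integral_tsum_of_summable_integral_norm hint (by
    simp_rw [hnorm]; exact summable_integral_norm_translates ha)
  simp_rw [tsum_const_smul''] at this
  rw [← this]
  refine tsum_congr fun n ↦ ?_
  rw [← integral_add_right_eq_self _ (x n), ← integral_const_mul]
  refine integral_congr_ae (.of_forall fun u ↦ ?_)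
  simp only [add_sub_cancel_right, smul_eq_mul]
  rw [show ((-2 * Real.pi * (u + x n) * τ : ℝ) : ℂ) * I =
    ((-2 * Real.pi * u * τ : ℝ) : ℂ) * I + -2 * Real.pi * x n * τ * I by push_cast; ring, exp_add]
  ring

end translates

section ramp

open MeasureTheory FourierTransform Set

lemma integral_exp_neg_mul_Ioi_zero {s : ℂ} (hs : 0 < s.re) :
    ∫ v : ℝ in Ioi 0, exp (-s * v) = 1 / s := by
  rw [integral_exp_mul_complex_Ioi (by simpa)]
  simp

lemma integrableOn_mul_exp_neg_mul_Ioi_zero {s : ℂ} (hs : 0 < s.re) :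
    IntegrableOn (fun v : ℝ ↦ v * exp (-s * v)) (Ioi 0) := by
  have h := integrableOn_rpow_mul_exp_neg_mul_rpow (p := 1) (s := 1) (by norm_num) one_pos hs
  simp only [Real.rpow_one] at h
  have hc : Continuous fun v : ℝ ↦ v * exp (-s * v) := by fun_prop
  refine h.mono' hc.aestronglyMeasurable ?_
  refine (ae_restrict_iff' measurableSet_Ioi).2 (.of_forall fun v hv ↦ ?_)
  rw [norm_mul, norm_real, norm_exp, Real.norm_of_nonneg (le_of_lt hv)]
  simp

lemma integral_mul_exp_neg_mul_Ioi_zero {s : ℂ} (hs : 0 < s.re) :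
    ∫ v : ℝ in Ioi 0, v * exp (-s * v) = 1 / s ^ 2 := by
  have hs0 : s ≠ 0 := by rintro rfl; simp at hs
  have hi := integrableOn_mul_exp_neg_mul_Ioi_zero hs
  have hi' : IntegrableOn (fun v : ℝ ↦ exp (-s * v)) (Ioi 0) :=
    integrableOn_exp_mul_complex_Ioi (by simpa) 0
  have hd (v : ℝ) : HasDerivAt (fun v : ℝ ↦ v * exp (-s * v))
      (exp (-s * v) - s * (v * exp (-s * v))) v := by
    have h1 : HasDerivAt (fun v : ℝ ↦ (v : ℂ)) 1 v := ofRealCLM.hasDerivAt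
    exact (h1.mul (h1.const_mul (-s)).cexp).congr_deriv (by ring)
  have hi2 := hi'.sub (hi.const_mul s)
  have h0 := tendsto_zero_of_hasDerivAt_of_integrableOn_Ioi (fun v _ ↦ hd v) hi2 hi
  have := integral_Ioi_of_hasDerivAt_of_tendsto' (fun v _ ↦ hd v) hi2 h0
  rw [integral_sub hi' (hi.const_mul s), integral_const_mul,
    integral_exp_neg_mul_Ioi_zero hs] at this
  simp only [ofReal_zero, zero_mul, sub_zero] at this
  field_simp at this ⊢
  linear_combination -this

lemma fourier_indicator_Ioi_zero (g : ℝ → ℂ) (τ : ℝ) :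
    𝓕 ((Ioi 0).indicator g) τ = ∫ v : ℝ in Ioi 0, exp (-(2 * Real.pi * τ * I) * v) * g v := by
  rw [Real.fourier_real_eq_integral_exp_smul, ← integral_indicator measurableSet_Ioi]
  refine integral_congr_ae (.of_forall fun v ↦ ?_)
  by_cases hv : v ∈ Ioi (0 : ℝ)
  · simp only [indicator_of_mem hv, smul_eq_mul]
    congr 2
    push_cast
    ring
  · simp [indicator_of_notMem hv]

variable {σ : ℝ}

/-- The one-sided function `exp (-σ v) - exp (-(1 + σ) v)`, `0 ≤ v`. -/
noncomputable def expKernel (σ v : ℝ) : ℂ :=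
  (Ioi (0 : ℝ)).indicator (fun v : ℝ ↦ exp (-σ * v) - exp (-(1 + σ) * v)) v

/-- The one-sided function `v * exp (-σ v)`, `0 ≤ v`. -/
noncomputable def rampKernel (σ v : ℝ) : ℂ :=
  (Ioi (0 : ℝ)).indicator (fun v : ℝ ↦ v * exp (-σ * v)) v

lemma continuous_indicator_Ioi_zero {g : ℝ → ℂ} (hg : Continuous g) (h0 : g 0 = 0) :
    Continuous ((Ioi 0).indicator g) := by
  have : (Ioi 0).indicator g = fun v ↦ g (max v 0) := by
    ext v
    rcases lt_or_ge 0 v with hv | hv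
    · rw [indicator_of_mem (mem_Ioi.2 hv), max_eq_left hv.le]
    · rw [indicator_of_notMem (by simpa), max_eq_right hv, h0]
  rw [this]
  fun_prop

lemma continuous_expKernel : Continuous (expKernel σ) :=
  continuous_indicator_Ioi_zero (by fun_prop) (by simp)

lemma continuous_rampKernel : Continuous (rampKernel σ) :=
  continuous_indicator_Ioi_zero (by fun_prop) (by simp)

lemma norm_expKernel_le (hσ : 0 < σ) (v : ℝ) : ‖expKernel σ v‖ ≤ 2 := by
  unfold expKernel
  by_cases hv : v ∈ Ioi (0 : ℝ)
  · rw [indicator_of_mem hv]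
    have hv' : 0 < v := hv
    have h1 : ‖exp (-σ * v)‖ ≤ 1 := by
      rw [norm_exp, Real.exp_le_one_iff]
      simp; positivity
    have h2 : ‖exp (-(1 + σ) * v)‖ ≤ 1 := by
      rw [norm_exp, Real.exp_le_one_iff]
      simp; nlinarith [mul_pos hσ hv']
    linarith [norm_sub_le (exp (-σ * v)) (exp (-(1 + σ) * v))]
  · simp [indicator_of_notMem hv]

lemma integrable_expKernel (hσ : 0 < σ) : Integrable (expKernel σ) := by
  refine (integrable_indicator_iff measurableSet_Ioi).2 ?_
  exact (integrableOn_exp_mul_complex_Ioi (by simpa) 0).sub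
    (integrableOn_exp_mul_complex_Ioi (by simp; linarith) 0)

lemma integrable_rampKernel (hσ : 0 < σ) : Integrable (rampKernel σ) :=
  (integrable_indicator_iff measurableSet_Ioi).2 (integrableOn_mul_exp_neg_mul_Ioi_zero (by simpa))

lemma fourier_expKernel (hσ : 0 < σ) (τ : ℝ) :
    𝓕 (expKernel σ) τ = 1 / ((σ + 2 * Real.pi * τ * I) * (σ + 2 * Real.pi * τ * I + 1)) := by
  set s : ℂ := σ + 2 * Real.pi * τ * I with hs_def
  have hs : 0 < s.re := by simpa [hs_def]
  have hs1 : 0 < (s + 1).re := by simp; linarith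
  have hs0 : s ≠ 0 := by intro h; simp [h] at hs
  have hs10 : s + 1 ≠ 0 := by intro h; simp [h] at hs1
  have : (fun v : ℝ ↦ exp (-(2 * Real.pi * τ * I) * v) *
      (exp (-σ * v) - exp (-(1 + σ) * v))) =
      fun v : ℝ ↦ exp (-s * v) - exp (-(s + 1) * v) := by
    ext v
    rw [mul_sub, ← exp_add, ← exp_add, hs_def]
    ring_nf
  unfold expKernel
  rw [fourier_indicator_Ioi_zero, this, integral_sub
    (integrableOn_exp_mul_complex_Ioi (by simpa) 0)
    (integrableOn_exp_mul_complex_Ioi (by rw [neg_re]; linarith) 0),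
    integral_exp_neg_mul_Ioi_zero hs, integral_exp_neg_mul_Ioi_zero hs1]
  field_simp
  ring

lemma fourier_rampKernel (hσ : 0 < σ) (τ : ℝ) :
    𝓕 (rampKernel σ) τ = 1 / (σ + 2 * Real.pi * τ * I) ^ 2 := by
  set s : ℂ := σ + 2 * Real.pi * τ * I with hs_def
  have hs : 0 < s.re := by simpa [hs_def]
  have : (fun v : ℝ ↦ exp (-(2 * Real.pi * τ * I) * v) * (v * exp (-σ * v))) =
      fun v : ℝ ↦ v * exp (-s * v) := by
    ext v
    rw [mul_left_comm, ← exp_add, hs_def]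
    ring_nf
  unfold rampKernel
  rw [fourier_indicator_Ioi_zero, this, integral_mul_exp_neg_mul_Ioi_zero hs]

lemma fourier_sub_apply {f g : ℝ → ℂ} (hf : Integrable f) (hg : Integrable g) (τ : ℝ) :
    𝓕 (fun u ↦ f u - g u) τ = 𝓕 f τ - 𝓕 g τ := by
  have h {f : ℝ → ℂ} (hf : Integrable f) := (Real.fourierIntegral_convergent_iff (f := f) τ).2 hf
  simp only [Real.fourier_eq, smul_sub]
  exact integral_sub (h hf) (h hg)

lemma fourier_const_mul_apply (c : ℂ) (f : ℝ → ℂ) (τ : ℝ) :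
    𝓕 (fun u ↦ c * f u) τ = c * 𝓕 f τ := by
  simp only [Real.fourier_real_eq_integral_exp_smul, ← integral_const_mul, smul_eq_mul]
  exact integral_congr_ae (.of_forall fun v ↦ by ring)

end ramp

section decay

open MeasureTheory FourierTransform Set

lemma sq_mul_norm_fourier_le {G G₁ G₂ : ℝ → ℂ} {w : ℝ → ℝ} (hG : ∀ τ, HasDerivAt G (G₁ τ) τ)
    (hG₁ : ∀ τ, HasDerivAt G₁ (G₂ τ) τ) (hG₂ : Continuous G₂) (hw : Integrable w)
    (h : ∀ τ, ‖G τ‖ ≤ w τ) (h₁ : ∀ τ, ‖G₁ τ‖ ≤ w τ) (h₂ : ∀ τ, ‖G₂ τ‖ ≤ w τ) (u : ℝ) :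
    (2 * Real.pi * u) ^ 2 * ‖𝓕 G u‖ ≤ ∫ τ, w τ := by
  have hd : Differentiable ℝ G := fun τ ↦ (hG τ).differentiableAt
  have hd₁ : Differentiable ℝ G₁ := fun τ ↦ (hG₁ τ).differentiableAt
  have he : deriv G = G₁ := funext fun τ ↦ (hG τ).deriv
  have he₁ : deriv G₁ = G₂ := funext fun τ ↦ (hG₁ τ).deriv
  have hi : Integrable G := hw.mono' hd.continuous.aestronglyMeasurable (.of_forall h)
  have hi₁ : Integrable G₁ := hw.mono' hd₁.continuous.aestronglyMeasurable (.of_forall h₁)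
  have hi₂ : Integrable G₂ := hw.mono' hG₂.aestronglyMeasurable (.of_forall h₂)
  have hF₁ := Real.fourier_deriv hi hd (he ▸ hi₁)
  have hF₂ := Real.fourier_deriv hi₁ hd₁ (he₁ ▸ hi₂)
  rw [he] at hF₁
  rw [he₁] at hF₂
  calc (2 * Real.pi * u) ^ 2 * ‖𝓕 G u‖ = ‖𝓕 G₂ u‖ := by
        rw [hF₂]
        simp only [hF₁, smul_eq_mul, norm_mul, norm_I, norm_real, Complex.norm_ofNat,
          Real.norm_eq_abs]
        rw [abs_of_pos Real.pi_pos, mul_pow, ← sq_abs u]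
        ring
    _ ≤ ∫ τ, ‖G₂ τ‖ := VectorFourier.norm_fourierIntegral_le_integral_norm _ _ _ _ _
    _ ≤ ∫ τ, w τ := integral_mono hi₂.norm hw h₂

lemma hasDerivAt_iteratedDeriv_zetaKernel_line {σ : ℝ} (hσ : 0 ≤ σ) (n : ℕ) (τ : ℝ) :
    HasDerivAt (fun τ : ℝ ↦ iteratedDeriv n zetaKernel (σ + 2 * Real.pi * τ * I))
      (2 * Real.pi * I * iteratedDeriv (n + 1) zetaKernel (σ + 2 * Real.pi * τ * I)) τ := by
  have hmem : (σ + 2 * Real.pi * τ * I : ℂ) ∈ zetaKernelDomain :=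
    mem_zetaKernelDomain_of_re_nonneg (by simpa)
  have h1 := ((differentiableOn_iteratedDeriv_zetaKernel n).differentiableAt
    (isOpen_zetaKernelDomain.mem_nhds hmem)).hasDerivAt
  rw [← iteratedDeriv_succ] at h1
  have h2 : HasDerivAt (fun τ : ℝ ↦ (σ + 2 * Real.pi * τ * I : ℂ)) (2 * Real.pi * I) τ := by
    have h3 : HasDerivAt (fun v : ℝ ↦ (v : ℂ)) 1 τ := ofRealCLM.hasDerivAt
    exact (((h3.const_mul (2 * Real.pi : ℂ)).mul_const I).const_add (σ : ℂ)).congr_deriv (by ring)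
  exact HasDerivAt.scomp τ h1 h2

lemma exists_sq_mul_norm_fourier_zetaKernel_le :
    ∃ C > 0, ∀ σ : ℝ, 0 ≤ σ → σ ≤ 1 →
      Integrable (fun τ : ℝ ↦ zetaKernel (σ + 2 * Real.pi * τ * I)) ∧
      ∀ u, (2 * Real.pi * u) ^ 2 *
        ‖𝓕 (fun τ : ℝ ↦ zetaKernel (σ + 2 * Real.pi * τ * I)) u‖ ≤ C := by
  obtain ⟨C, hC, hb⟩ := exists_norm_iteratedDeriv_zetaKernel_le
  have hπ : 1 ≤ 2 * Real.pi := by linarith [Real.pi_gt_three]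
  let w : ℝ → ℝ := fun τ ↦ (2 * Real.pi) ^ 2 * (C * (1 + ‖τ‖) ^ (-(3 / 2) : ℝ))
  have hw : Integrable w :=
    ((integrable_one_add_norm (by norm_num)).const_mul C).const_mul _
  have hw0 : 0 ≤ ∫ τ, w τ := integral_nonneg fun τ ↦ by positivity
  refine ⟨(∫ τ, w τ) + 1, by positivity, fun σ hσ hσ1 ↦ ?_⟩
  have hbound (n : ℕ) (hn : n ≤ 2) (τ : ℝ) :
      ‖(2 * Real.pi * I : ℂ) ^ n * iteratedDeriv n zetaKernel (σ + 2 * Real.pi * τ * I)‖ ≤ w τ := by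
    have h2π : ‖(2 * Real.pi * I : ℂ)‖ = 2 * Real.pi := by
      simp [abs_of_pos Real.pi_pos]
    rw [norm_mul, norm_pow, h2π]
    refine mul_le_mul (pow_le_pow_right₀ hπ hn) ?_ (norm_nonneg _) (by positivity)
    refine (hb _ (by simpa) (by simpa) n hn).trans ?_
    refine mul_le_mul_of_nonneg_left ?_ hC.le
    refine Real.rpow_le_rpow_of_nonpos (by positivity) ?_ (by norm_num)
    have : (σ + 2 * Real.pi * τ * I : ℂ).im = 2 * Real.pi * τ := by simp
    rw [this, abs_mul, abs_of_pos (by positivity : 0 < 2 * Real.pi), Real.norm_eq_abs]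
    nlinarith [abs_nonneg τ]
  have hd0 := hasDerivAt_iteratedDeriv_zetaKernel_line hσ 0
  have hd1 := hasDerivAt_iteratedDeriv_zetaKernel_line hσ 1
  have hd2 := hasDerivAt_iteratedDeriv_zetaKernel_line hσ 2
  have hb0 := hbound 0 (by norm_num)
  simp only [iteratedDeriv_zero, pow_zero, one_mul] at hd0 hb0
  have hc0 : Continuous fun τ : ℝ ↦ zetaKernel (σ + 2 * Real.pi * τ * I) :=
    continuous_iff_continuousAt.2 fun τ ↦ (hd0 τ).continuousAt
  have hc2 : Continuous fun τ : ℝ ↦ iteratedDeriv 2 zetaKernel (σ + 2 * Real.pi * τ * I) :=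
    continuous_iff_continuousAt.2 fun τ ↦ (hd2 τ).continuousAt
  refine ⟨hw.mono' hc0.aestronglyMeasurable (.of_forall hb0), fun u ↦ ?_⟩
  refine (sq_mul_norm_fourier_le hd0 (G₂ := fun τ ↦ (2 * Real.pi * I : ℂ) ^ 2 *
    iteratedDeriv 2 zetaKernel (σ + 2 * Real.pi * τ * I)) (fun τ ↦ ?_) (by fun_prop) hw hb0
    (fun τ ↦ by simpa using hbound 1 (by norm_num) τ) (hbound 2 le_rfl) u).trans (by linarith)
  exact ((hd1 τ).const_mul (2 * Real.pi * I : ℂ)).congr_deriv (by ring)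

end decay

section remainder

open MeasureTheory FourierTransform Set
open scoped ArithmeticFunction.vonMangoldt

/-- The smoothed difference between `∑ Λ(n) / n` and its main term, damped by `exp (-σ u)`. -/
noncomputable def smoothRemainder (σ u : ℝ) : ℂ :=
  (∑' n : ℕ, LSeries.term (fun n ↦ Λ n) (1 + σ) n * expKernel σ (u - Real.log n)) -
    (rampKernel σ u - (1 + Real.eulerMascheroniConstant) * expKernel σ u)

variable {σ : ℝ}

lemma summable_term_vonMangoldt (hσ : 0 < σ) :
    Summable (LSeries.term (fun n ↦ (Λ n : ℂ)) (1 + σ)) :=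
  ArithmeticFunction.LSeriesSummable_vonMangoldt (by simpa)

lemma continuous_smoothRemainder (hσ : 0 < σ) : Continuous (smoothRemainder σ) :=
  (continuous_tsum_translates (summable_term_vonMangoldt hσ) continuous_expKernel
    (norm_expKernel_le hσ)).sub
    (continuous_rampKernel.sub (continuous_expKernel.const_smul (1 + Real.eulerMascheroniConstant : ℂ)))

lemma integrable_smoothRemainder (hσ : 0 < σ) : Integrable (smoothRemainder σ) :=
  (integrable_tsum_translates (summable_term_vonMangoldt hσ) continuous_expKernel
    (integrable_expKernel hσ) (norm_expKernel_le hσ)).sub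
    ((integrable_rampKernel hσ).sub ((integrable_expKernel hσ).const_mul _))

lemma tsum_term_mul_exp (a : ℕ → ℂ) (τ : ℝ) :
    ∑' n : ℕ, LSeries.term a (1 + σ) n * exp (-2 * Real.pi * Real.log n * τ * I) =
      LSeries a (1 + (σ + 2 * Real.pi * τ * I)) := by
  refine tsum_congr fun n ↦ ?_
  rcases eq_or_ne n 0 with rfl | hn
  · simp
  · have hn' : (n : ℂ) ≠ 0 := by exact_mod_cast hn
    rw [LSeries.term_of_ne_zero hn, LSeries.term_of_ne_zero hn, ← add_assoc, cpow_add _ (2 * _ * _ * I) hn',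
      ← div_div, div_eq_mul_inv _ ((n : ℂ) ^ (_ * I)), ← cpow_neg, cpow_def_of_ne_zero hn' (-_),
      ← natCast_log]
    congr 2
    ring

lemma fourier_smoothRemainder (hσ : 0 < σ) :
    𝓕 (smoothRemainder σ) = fun τ : ℝ ↦ zetaKernel (σ + 2 * Real.pi * τ * I) := by
  ext τ
  set s : ℂ := σ + 2 * Real.pi * τ * I with hs_def
  have hs : 0 < s.re := by simpa [hs_def]
  have hs0 : s ≠ 0 := by intro h; simp [h] at hs
  have hs10 : s + 1 ≠ 0 := by
    intro h
    rw [eq_neg_of_add_eq_zero_left h] at hs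
    norm_num at hs
  have hζ : riemannZeta (1 + s) ≠ 0 := riemannZeta_ne_zero_of_one_le_re (by simp [hs.le])
  unfold smoothRemainder
  have hr := integrable_rampKernel hσ
  have he := (integrable_expKernel hσ).const_mul (1 + Real.eulerMascheroniConstant : ℂ)
  have hre : Integrable fun u ↦ rampKernel σ u -
    (1 + Real.eulerMascheroniConstant) * expKernel σ u := hr.sub he
  rw [fourier_sub_apply (integrable_tsum_translates (summable_term_vonMangoldt hσ)
      continuous_expKernel (integrable_expKernel hσ) (norm_expKernel_le hσ)) hre,
    fourier_sub_apply hr he,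
    fourier_const_mul_apply, fourier_tsum_translates (summable_term_vonMangoldt hσ)
      (integrable_expKernel hσ), fourier_expKernel hσ, fourier_rampKernel hσ, tsum_term_mul_exp,
    ← hs_def, ArithmeticFunction.LSeries_vonMangoldt_eq_deriv_riemannZeta_div (by simpa),
    zetaKernel_eq hs0 hζ]
  field_simp
  ring

lemma exists_sq_mul_norm_smoothRemainder_le :
    ∃ C > 0, ∀ σ : ℝ, 0 < σ → σ ≤ 1 → ∀ u : ℝ, u ^ 2 * ‖smoothRemainder σ u‖ ≤ C := by
  obtain ⟨C, hC, h⟩ := exists_sq_mul_norm_fourier_zetaKernel_le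
  refine ⟨C, hC, fun σ hσ hσ1 u ↦ ?_⟩
  obtain ⟨hi, hb⟩ := h σ hσ.le hσ1
  have hF := fourier_smoothRemainder hσ
  have hinv := (continuous_smoothRemainder hσ).fourierInv_fourier_eq
    (integrable_smoothRemainder hσ) (hF ▸ hi)
  rw [← hinv, Real.fourierInv_eq_fourier_neg, hF]
  refine le_trans ?_ (hb (-u))
  gcongr ?_ * _
  have : 1 ≤ (2 * Real.pi) ^ 2 := one_le_pow₀ (by linarith [Real.pi_gt_three])
  nlinarith [mul_nonneg (sub_nonneg.2 this) (sq_nonneg u)]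

end remainder

section tauberian

open Finset
open scoped ArithmeticFunction.vonMangoldt

/-- The sum of `Λ(n) / n` over `n ≤ x`. -/
noncomputable def vonMangoldtDivSum (x : ℝ) : ℝ := ∑ n ∈ range (⌊x⌋₊ + 1), Λ n / n

/-- The sum of `Λ(n) / n * (x - n)` over `n ≤ x`. -/
noncomputable def vonMangoldtDivRieszSum (x : ℝ) : ℝ :=
  ∑ n ∈ range (⌊x⌋₊ + 1), Λ n / n * (x - n)

/-- The relative error in the asymptotic expansion of `vonMangoldtDivRieszSum`. -/
noncomputable def rieszError (x : ℝ) : ℝ :=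
  vonMangoldtDivRieszSum x / x - (Real.log x - (1 + Real.eulerMascheroniConstant) * (1 - 1 / x))

lemma smoothRemainder_log {x : ℝ} (hx : 1 < x) (σ : ℝ) :
    smoothRemainder σ (Real.log x) = (Real.exp (-σ * Real.log x) * rieszError x : ℝ) := by
  have hx0 : 0 < x := by linarith
  have hlog : 0 < Real.log x := Real.log_pos hx
  have hexp : Real.exp (-(1 + σ) * Real.log x) = Real.exp (-σ * Real.log x) / x := by
    rw [show -(1 + σ) * Real.log x = -σ * Real.log x - Real.log x by ring, Real.exp_sub,
      Real.exp_log hx0]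
  have hker {v : ℝ} (hv : 0 ≤ v) :
      expKernel σ v = (Real.exp (-σ * v) - Real.exp (-(1 + σ) * v) : ℝ) := by
    rcases hv.eq_or_lt with rfl | hv
    · simp [expKernel]
    · rw [expKernel, Set.indicator_of_mem (Set.mem_Ioi.2 hv)]
      push_cast
      rfl
  have hramp : rampKernel σ (Real.log x) = (Real.log x * Real.exp (-σ * Real.log x) : ℝ) := by
    rw [rampKernel, Set.indicator_of_mem (Set.mem_Ioi.2 hlog)]
    push_cast
    rfl
  have hsum : ∑' n : ℕ, LSeries.term (fun n ↦ (Λ n : ℂ)) (1 + σ) n *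
      expKernel σ (Real.log x - Real.log n) =
      (Real.exp (-σ * Real.log x) * (vonMangoldtDivRieszSum x / x) : ℝ) := by
    rw [tsum_eq_sum (s := range (⌊x⌋₊ + 1)) fun n hn ↦ ?_, vonMangoldtDivRieszSum, sum_div,
      mul_sum, ofReal_sum]
    · refine sum_congr rfl fun n hn ↦ ?_
      rcases eq_or_ne n 0 with rfl | hn0
      · simp
      have hn1 : (0 : ℝ) < n := by exact_mod_cast Nat.pos_of_ne_zero hn0
      have hnx : (n : ℝ) ≤ x := (Nat.le_floor_iff hx0.le).1 (by simpa [Nat.lt_succ_iff] using hn)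
      rw [hker (sub_nonneg.2 (Real.log_le_log hn1 hnx)), LSeries.term_of_ne_zero hn0]
      have hpow : ((n : ℂ) ^ (1 + σ : ℂ)) = (n * Real.exp (σ * Real.log n) : ℝ) := by
        rw [cpow_add _ _ (by exact_mod_cast hn0), cpow_one,
          cpow_def_of_ne_zero (by exact_mod_cast hn0), ← natCast_log]
        push_cast
        ring_nf
      rw [hpow, ← ofReal_div, ← ofReal_mul]
      congr 1
      have h1 : Real.exp (-σ * (Real.log x - Real.log n)) =
          Real.exp (-σ * Real.log x) * Real.exp (σ * Real.log n) := by
        rw [← Real.exp_add]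
        ring_nf
      have h2 : Real.exp (-(1 + σ) * (Real.log x - Real.log n)) =
          Real.exp (-σ * Real.log x) / x * (n * Real.exp (σ * Real.log n)) := by
        rw [show -(1 + σ) * (Real.log x - Real.log n) =
          -(1 + σ) * Real.log x + (Real.log n + σ * Real.log n) by ring, Real.exp_add,
          Real.exp_add, hexp, Real.exp_log hn1]
      rw [h1, h2]
      have := (Real.exp_pos (σ * Real.log n)).ne'
      field_simp
    · have hn' : x < n := (Nat.floor_lt hx0.le).1 (by simpa [Nat.lt_succ_iff] using hn)
      have : Real.log x - Real.log n ≤ 0 := sub_nonpos.2 (Real.log_le_log hx0 hn'.le)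
      rw [expKernel, Set.indicator_of_notMem (by simpa using this), mul_zero]
  rw [smoothRemainder, hsum, hramp, hker hlog.le, hexp, rieszError]
  push_cast
  ring

lemma exists_abs_rieszError_le :
    ∃ K > 0, ∀ x : ℝ, 0 < x → 1 ≤ Real.log x → |rieszError x| ≤ K / Real.log x ^ 2 := by
  obtain ⟨C, hC, h⟩ := exists_sq_mul_norm_smoothRemainder_le
  refine ⟨Real.exp 1 * C, by positivity, fun x hx0 hx ↦ ?_⟩
  have hlog : 0 < Real.log x := by linarith
  have hx1 : 1 < x := (Real.log_pos_iff hx0.le).1 hlog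
  have := h (1 / Real.log x) (by positivity) (div_le_one_of_le₀ hx hlog.le) (Real.log x)
  rw [smoothRemainder_log hx1, norm_real, Real.norm_eq_abs, abs_mul, Real.abs_exp,
    show -(1 / Real.log x) * Real.log x = -1 by field_simp, Real.exp_neg] at this
  rw [le_div_iff₀ (by positivity)]
  field_simp at this
  linarith

lemma vonMangoldtDivRieszSum_add_le {y : ℝ} (x : ℝ) (hy : 0 ≤ y) :
    vonMangoldtDivRieszSum x + (y - x) * vonMangoldtDivSum x ≤ vonMangoldtDivRieszSum y := by
  have hL (n : ℕ) : 0 ≤ Λ n / n := div_nonneg ArithmeticFunction.vonMangoldt_nonneg n.cast_nonneg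
  have heq : vonMangoldtDivRieszSum x + (y - x) * vonMangoldtDivSum x =
      ∑ n ∈ range (⌊x⌋₊ + 1), Λ n / n * (y - n) := by
    rw [vonMangoldtDivRieszSum, vonMangoldtDivSum, mul_sum, ← sum_add_distrib]
    exact sum_congr rfl fun n _ ↦ by ring
  rw [heq, vonMangoldtDivRieszSum]
  rcases le_total x y with hxy | hxy
  · refine sum_le_sum_of_subset_of_nonneg (range_mono (by gcongr)) fun n hn _ ↦ ?_
    refine mul_nonneg (hL n) (sub_nonneg.2 ?_)
    exact (Nat.le_floor_iff hy).1 (by simpa [Nat.lt_succ_iff] using hn)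
  · rw [← sum_sdiff (range_mono (by gcongr : ⌊y⌋₊ + 1 ≤ ⌊x⌋₊ + 1)), add_le_iff_nonpos_left]
    refine sum_nonpos fun n hn ↦ mul_nonpos_of_nonneg_of_nonpos (hL n) (sub_nonpos.2 ?_)
    have := (mem_sdiff.1 hn).2
    exact ((Nat.floor_lt hy).1 (by simpa [Nat.lt_succ_iff] using this)).le

lemma vonMangoldtDivRieszSum_eq {x : ℝ} (hx : x ≠ 0) :
    vonMangoldtDivRieszSum x = x * Real.log x -
      (1 + Real.eulerMascheroniConstant) * (x - 1) + x * rieszError x := by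
  rw [rieszError]
  field_simp
  ring

lemma exists_abs_vonMangoldtDivSum_le_of_two_le_log :
    ∃ C > 0, ∀ x : ℝ, 0 < x → 2 ≤ Real.log x →
      |vonMangoldtDivSum x - Real.log x + Real.eulerMascheroniConstant| ≤ C / Real.log x := by
  obtain ⟨K, hK, h⟩ := exists_abs_rieszError_le
  refine ⟨1 + 10 * K, by positivity, fun x hx hx2 ↦ ?_⟩
  set L := Real.log x with hL
  set S := vonMangoldtDivSum x
  have hL0 : 0 < L := by linarith
  have hEx := abs_le.1 (h x hx (by linarith))
  rw [← hL] at hEx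
  have hTx := vonMangoldtDivRieszSum_eq hx.ne'
  rw [← hL] at hTx
  rw [abs_le]
  constructor
  · set η := 1 / (2 * L) with hη
    have hη0 : 0 < η := by positivity
    have hηL : η * L = 1 / 2 := by rw [hη]; field_simp
    have hη4 : η ≤ 1 / 4 := by
      rw [hη]
      exact one_div_le_one_div_of_le (by norm_num) (by linarith)
    have hz : 0 < x * (1 - η) := mul_pos hx (by linarith)
    have hlogz : Real.log (x * (1 - η)) = L + Real.log (1 - η) :=
      Real.log_mul hx.ne' (by linarith)
    have hlog1 : Real.log (1 - η) ≤ -η := by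
      linarith [Real.log_le_sub_one_of_pos (by linarith : 0 < 1 - η)]
    have hlog2 : -(1 / 2) ≤ Real.log (1 - η) := by
      have h1 := Real.one_sub_inv_le_log_of_pos (by linarith : 0 < 1 - η)
      have h2 : (1 - η)⁻¹ ≤ 3 / 2 := by
        rw [inv_le_comm₀ (by linarith) (by norm_num)]
        linarith
      linarith
    have hEz := abs_le.1 (h (x * (1 - η)) hz (by linarith))
    have hbd : K / Real.log (x * (1 - η)) ^ 2 ≤ 4 * K / L ^ 2 := by
      rw [div_le_div_iff₀ (by rw [hlogz]; nlinarith) (by positivity)]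
      have : L / 2 ≤ Real.log (x * (1 - η)) := by linarith
      nlinarith [mul_self_le_mul_self (by positivity) this]
    have hTz := vonMangoldtDivRieszSum_eq hz.ne'
    rw [hlogz] at hTz
    have hsub := vonMangoldtDivRieszSum_add_le x hz.le
    rw [hTx, hTz] at hsub
    have hdiv : (1 - η) * (L + Real.log (1 - η)) + (1 + Real.eulerMascheroniConstant) * η +
        (1 - η) * rieszError (x * (1 - η)) - L - rieszError x + η * S ≥ 0 := by
      refine nonneg_of_mul_nonneg_right (a := x) ?_ hx
      linarith
    have hKL : K / L ^ 2 = K * (2 * η) ^ 2 := by rw [hη]; field_simp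
    have hKL' : 4 * K / L ^ 2 = 4 * K * (2 * η) ^ 2 := by rw [hη]; field_simp
    rw [hKL] at hEx
    rw [hKL'] at hbd
    have h1 : (1 - η) * rieszError (x * (1 - η)) ≤ 4 * K * (2 * η) ^ 2 :=
      (mul_le_mul_of_nonneg_left (hEz.2.trans hbd) (by linarith)).trans
        (mul_le_of_le_one_left (by positivity) (by linarith))
    have h2 : (1 - η) * Real.log (1 - η) ≤ (1 - η) * -η :=
      mul_le_mul_of_nonneg_left hlog1 (by linarith)
    have h3 : 0 ≤ η * (S - L + Real.eulerMascheroniConstant + η + 20 * K * η) := by linarith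
    have h4 := nonneg_of_mul_nonneg_right h3 hη0
    have h5 : (1 + 10 * K) / L = (1 + 10 * K) * (2 * η) := by rw [hη]; field_simp
    rw [h5]
    linarith
  · set η := 1 / L with hη
    have hη0 : 0 < η := by positivity
    have hηL : η * L = 1 := by rw [hη]; field_simp
    have hη1 : η ≤ 1 := by
      rw [hη, div_le_one hL0]
      linarith
    have hy : 0 < x * (1 + η) := by positivity
    have hlogy : Real.log (x * (1 + η)) = L + Real.log (1 + η) :=
      Real.log_mul hx.ne' (by linarith)
    have hlog1 : Real.log (1 + η) ≤ η := by
      linarith [Real.log_le_sub_one_of_pos (by linarith : 0 < 1 + η)]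
    have hlog2 : 0 ≤ Real.log (1 + η) := Real.log_nonneg (by linarith)
    have hEy := abs_le.1 (h (x * (1 + η)) hy (by linarith))
    have hbd : K / Real.log (x * (1 + η)) ^ 2 ≤ K / L ^ 2 := by
      gcongr
      linarith
    have hTy := vonMangoldtDivRieszSum_eq hy.ne'
    rw [hlogy] at hTy
    have hsub := vonMangoldtDivRieszSum_add_le x hy.le
    rw [hTx, hTy] at hsub
    have hdiv : 0 ≤ (1 + η) * (L + Real.log (1 + η)) - (1 + Real.eulerMascheroniConstant) * η +
        (1 + η) * rieszError (x * (1 + η)) - L - rieszError x - η * S := by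
      refine nonneg_of_mul_nonneg_right (a := x) ?_ hx
      linarith
    have hKL : K / L ^ 2 = K * η ^ 2 := by rw [hη]; field_simp
    rw [hKL] at hEx hbd
    have h1 : (1 + η) * rieszError (x * (1 + η)) ≤ 2 * (K * η ^ 2) :=
      (mul_le_mul_of_nonneg_left (hEy.2.trans hbd) (by linarith)).trans
        (mul_le_mul_of_nonneg_right (by linarith) (by positivity))
    have h2 : (1 + η) * Real.log (1 + η) ≤ (1 + η) * η :=
      mul_le_mul_of_nonneg_left hlog1 (by linarith)
    have h3 : 0 ≤ η * (η + 3 * K * η - (S - L + Real.eulerMascheroniConstant)) := by linarith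
    have h4 := nonneg_of_mul_nonneg_right h3 hη0
    have h5 : (1 + 10 * K) / L = (1 + 10 * K) * η := by rw [hη]; field_simp
    rw [h5]
    nlinarith [mul_pos hK hη0]

end tauberian

section conclusion

open Finset
open scoped ArithmeticFunction.vonMangoldt

lemma sum_prime_sum_log_div_pow_eq_vonMangoldtDivSum {x : ℝ} (hx : 0 ≤ x) :
    (∑ p ∈ (range (⌊x⌋₊ + 1)).filter Nat.Prime, ∑ j ∈ Icc 1 ⌊x⌋₊,
      if ((p : ℝ) ^ j ≤ x) then Real.log p / (p : ℝ) ^ j else 0) = vonMangoldtDivSum x := by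
  have hfilter : vonMangoldtDivSum x =
      ∑ n ∈ (range (⌊x⌋₊ + 1)).filter IsPrimePow, Λ n / n := by
    refine (sum_filter_of_ne fun n _ hn ↦ ?_).symm
    refine ArithmeticFunction.vonMangoldt_ne_zero_iff.1 fun h ↦ hn ?_
    simp [h]
  rw [hfilter, ← sum_product', ← sum_filter]
  refine sum_bij (fun q _ ↦ q.1 ^ q.2) ?_ ?_ ?_ ?_
  · rintro ⟨p, j⟩ h
    simp only [mem_filter, mem_product, mem_range, mem_Icc] at h ⊢
    obtain ⟨⟨⟨-, hp⟩, hj, -⟩, hle⟩ := h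
    exact ⟨Nat.lt_succ_of_le (Nat.le_floor (by exact_mod_cast hle)),
      hp.isPrimePow.pow (by omega)⟩
  · rintro ⟨p, j⟩ h ⟨q, k⟩ h' heq
    simp only [mem_filter, mem_product, mem_range, mem_Icc] at h h' heq
    obtain ⟨h1, h2⟩ := h.1.1.2.pow_inj' h'.1.1.2 (by omega) (by omega) heq
    rw [h1, h2]
  · rintro n hn
    simp only [mem_filter, mem_range] at hn
    obtain ⟨hlt, hpp⟩ := hn
    obtain ⟨p, k, hp, hk, rfl⟩ := (isPrimePow_nat_iff n).1 hpp
    have hle : p ^ k ≤ ⌊x⌋₊ := Nat.le_of_lt_succ hlt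
    refine ⟨(p, k), ?_, rfl⟩
    simp only [mem_filter, mem_product, mem_range, mem_Icc]
    refine ⟨⟨⟨Nat.lt_succ_of_le ((Nat.le_self_pow hk.ne' p).trans hle), hp⟩, hk,
      ((Nat.lt_pow_self hp.one_lt).le).trans hle⟩, ?_⟩
    exact_mod_cast (Nat.le_floor_iff hx).1 hle
  · rintro ⟨p, j⟩ h
    simp only [mem_filter, mem_product, mem_range, mem_Icc] at h
    rw [ArithmeticFunction.vonMangoldt_apply_pow (by omega),
      ArithmeticFunction.vonMangoldt_apply_prime h.1.1.2]
    push_cast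
    rfl

lemma vonMangoldtDivSum_nonneg (x : ℝ) : 0 ≤ vonMangoldtDivSum x :=
  sum_nonneg fun n _ ↦ div_nonneg ArithmeticFunction.vonMangoldt_nonneg n.cast_nonneg

lemma vonMangoldtDivSum_mono : Monotone vonMangoldtDivSum := fun x y hxy ↦
  sum_le_sum_of_subset_of_nonneg (range_mono (by gcongr)) fun n _ _ ↦
    div_nonneg ArithmeticFunction.vonMangoldt_nonneg n.cast_nonneg

lemma exists_abs_vonMangoldtDivSum_le :
    ∃ C > 0, ∀ x : ℝ, 2 ≤ x →
      |vonMangoldtDivSum x - Real.log x + Real.eulerMascheroniConstant| ≤ C / Real.log x := by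
  obtain ⟨C, hC, h⟩ := exists_abs_vonMangoldtDivSum_le_of_two_le_log
  have hB := vonMangoldtDivSum_nonneg (Real.exp 2)
  refine ⟨C + 2 * (vonMangoldtDivSum (Real.exp 2) + 3), by positivity, fun x hx ↦ ?_⟩
  have hx0 : 0 < x := by linarith
  have hlog : 0 < Real.log x := Real.log_pos (by linarith)
  rcases le_or_gt 2 (Real.log x) with h2 | h2
  · refine (h x hx0 h2).trans ?_
    gcongr
    linarith
  · rw [le_div_iff₀ hlog]
    have hle : vonMangoldtDivSum x ≤ vonMangoldtDivSum (Real.exp 2) :=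
      vonMangoldtDivSum_mono ((Real.log_lt_iff_lt_exp hx0).1 h2).le
    have h0 := vonMangoldtDivSum_nonneg x
    have hγ := Real.eulerMascheroniConstant_lt_two_thirds
    have hγ' := Real.one_half_lt_eulerMascheroniConstant
    have habs : |vonMangoldtDivSum x - Real.log x + Real.eulerMascheroniConstant| ≤
        vonMangoldtDivSum (Real.exp 2) + 3 := abs_le.2 ⟨by linarith, by linarith⟩
    calc _ ≤ (vonMangoldtDivSum (Real.exp 2) + 3) * 2 := by gcongr
      _ ≤ _ := by linarith

end conclusion

end

/-- There exists `C > 0` such that for all real `x ≥ 2`,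
`|Σ_{p^j ≤ x} (log p)/p^j − log x + γ| ≤ C/log x`, the sum being over prime powers
`p^j ≤ x` with `p` prime and `j ≥ 1`. -/
theorem sum_log_p_div_p_pow_asymp :
    ∃ C > 0, ∀ x : ℝ, 2 ≤ x →
      |(∑ p ∈ (Finset.range (⌊x⌋₊ + 1)).filter Nat.Prime,
          ∑ j ∈ Finset.Icc 1 ⌊x⌋₊,
            if ((p : ℝ) ^ j ≤ x) then Real.log p / (p : ℝ) ^ j else 0)
        - Real.log x + Real.eulerMascheroniConstant| ≤ C / Real.log x := by
  obtain ⟨C, hC, h⟩ := exists_abs_vonMangoldtDivSum_le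
  refine ⟨C, hC, fun x hx ↦ ?_⟩
  rw [sum_prime_sum_log_div_pow_eq_vonMangoldtDivSum (by linarith)]
  exact h x hx
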